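/- Let G be a connected graph on n vertices. Then |ET(G)| ≥ 2^{n−1}, and consequently log₂ |ET(G)| ≥ n − 1. -/

import Mathlib

/-- A rooted tree on a node set `α`, given by its root and parent function
(the root is its own parent, and every node reaches the root by iterating `parent`). -/
structure RTree (α : Type*) where
  root : α
  parent : α → α
  parent_root : parent root = root
  reaches_root : ∀ v, ∃ k, parent^[k] v = root

namespace RTree

variable {α : Type*}

/-- `u` is a (weak) ancestor of `v` in `T`. -/
def ancestor (T : RTree α) (u v : α) : Prop := ∃ k, T.parent^[k] v = u

/-- `u` is a proper ancestor of `v` in `T`. -/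
def properAncestor (T : RTree α) (u v : α) : Prop := T.ancestor u v ∧ u ≠ v

/-- The node set of the subtree `T_v` of `T` rooted at `v`,
i.e. `v` together with all of its descendants. -/
def subtree (T : RTree α) (v : α) : Set α := {u | T.ancestor v u}

/-- A leaf of `T` is a node with no children. -/
def IsLeaf (T : RTree α) (v : α) : Prop := ∀ u, T.parent u = v → u = v

end RTree

/-- `T` is an elimination tree on the (connected) graph `G`: every subtree of `T` induces a
connected subgraph of `G`, and every edge of `G` joins an ancestor-descendant pair of `T`.
(For connected `G` this is equivalent to the recursive definition: some vertex `r` is the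
root, and the child subtrees of `r` are elimination trees on the components of `G − r`.) -/
def IsElimTree {α : Type*} (G : SimpleGraph α) (T : RTree α) : Prop :=
  (∀ v : α, (G.induce (T.subtree v)).Connected) ∧
  (∀ u v : α, G.Adj u v → T.ancestor u v ∨ T.ancestor v u)

/-- `T` is the Cartesian tree `Ind(G,p)`: the (unique) elimination tree on `G` in which
`p(u) < p(v)` whenever `u` is a proper ancestor of `v`. -/
def IsCartesianTree {α : Type*} (G : SimpleGraph α) (p : α → ℝ) (T : RTree α) : Prop :=
  IsElimTree G T ∧ ∀ u v : α, T.properAncestor u v → p u < p v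

/-- `T` is a rooting of the tree `G`: the parent-child pairs of `T` are exactly the edges
of `G`. -/
def IsRooting {α : Type*} (G : SimpleGraph α) (T : RTree α) : Prop :=
  ∀ u v : α, G.Adj u v ↔ ((T.parent u = v ∧ u ≠ v) ∨ (T.parent v = u ∧ v ≠ u))

/-- `p` is a `T`-monotone priority function: `p` is injective and `p(v) < p(u)` whenever
`u` is a proper ancestor of `v` in `T`. -/
def IsMonotonePriority {α : Type*} (T : RTree α) (p : α → ℝ) : Prop :=
  Function.Injective p ∧ ∀ u v : α, T.properAncestor u v → p v < p u

namespace RTree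

variable {α : Type*}

theorem ext_root_parent {S T : RTree α} (hr : S.root = T.root) (hp : S.parent = T.parent) :
    S = T := by
  cases S; cases T; simp_all

instance [Finite α] : Finite (RTree α) :=
  Finite.of_injective (fun T : RTree α => (T.root, T.parent)) fun S T h => by
    simp only [Prod.mk.injEq] at h
    exact ext_root_parent h.1 h.2

theorem iterate_parent_root (T : RTree α) (k : ℕ) : T.parent^[k] T.root = T.root :=
  Function.iterate_fixed T.parent_root k

theorem ancestor_refl (T : RTree α) (v : α) : T.ancestor v v := ⟨0, rfl⟩

section AddRoot

variable {u : α}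

open Classical in
/-- The parent function of `RTree.addRoot`. -/
noncomputable def addRootParent (S : RTree ↥({u}ᶜ : Set α)) (x : α) : α :=
  if h : x = u then u
  else if (⟨x, h⟩ : ↥({u}ᶜ : Set α)) = S.root then u
  else S.parent ⟨x, h⟩

theorem addRootParent_self (S : RTree ↥({u}ᶜ : Set α)) : S.addRootParent u = u := by
  simp [addRootParent]

theorem addRootParent_root (S : RTree ↥({u}ᶜ : Set α)) : S.addRootParent S.root = u := by
  simp [addRootParent]

theorem addRootParent_of_ne (S : RTree ↥({u}ᶜ : Set α)) {x : ↥({u}ᶜ : Set α)}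
    (hx : x ≠ S.root) : S.addRootParent x = S.parent x := by
  have h : (x : α) ≠ u := x.2
  simp [addRootParent, h, hx]

theorem exists_iterate_addRootParent_eq (S : RTree ↥({u}ᶜ : Set α)) {x y : ↥({u}ᶜ : Set α)}
    (h : S.ancestor x y) : ∃ k, S.addRootParent^[k] (y : α) = x := by
  obtain ⟨k, hk⟩ := h
  induction k generalizing y with
  | zero => exact ⟨0, congrArg Subtype.val hk⟩
  | succ k ih =>
    by_cases hy : y = S.root
    · subst hy
      rw [iterate_parent_root] at hk
      exact ⟨0, congrArg Subtype.val hk⟩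
    · obtain ⟨j, hj⟩ := ih hk
      exact ⟨j + 1, by rw [Function.iterate_succ_apply, addRootParent_of_ne S hy, hj]⟩

/-- The tree obtained from `S` by adding `u` as a new root above the root of `S`. -/
noncomputable def addRoot (S : RTree ↥({u}ᶜ : Set α)) : RTree α where
  root := u
  parent := S.addRootParent
  parent_root := S.addRootParent_self
  reaches_root v := by
    by_cases hv : v = u
    · exact ⟨0, hv⟩
    · obtain ⟨k, hk⟩ := S.exists_iterate_addRootParent_eq (S.reaches_root ⟨v, hv⟩)
      exact ⟨k + 1, by rw [Function.iterate_succ_apply', hk, addRootParent_root]⟩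

theorem addRoot_ancestor_root (S : RTree ↥({u}ᶜ : Set α)) (v : α) : S.addRoot.ancestor u v :=
  S.addRoot.reaches_root v

theorem addRoot_ancestor_iff (S : RTree ↥({u}ᶜ : Set α)) {x y : ↥({u}ᶜ : Set α)} :
    S.addRoot.ancestor (x : α) y ↔ S.ancestor x y := by
  refine ⟨?_, S.exists_iterate_addRootParent_eq⟩
  rintro ⟨k, hk⟩
  induction k generalizing y with
  | zero => exact ⟨0, Subtype.ext hk⟩
  | succ k ih =>
    rw [Function.iterate_succ_apply] at hk
    by_cases hy : y = S.root
    · subst hy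
      have hu : S.addRoot.parent S.root = S.addRoot.root := S.addRootParent_root
      rw [hu, iterate_parent_root] at hk
      exact absurd hk.symm x.2
    · have hp : S.addRoot.parent y = S.parent y := S.addRootParent_of_ne hy
      rw [hp] at hk
      obtain ⟨j, hj⟩ := ih hk
      exact ⟨j + 1, hj⟩

theorem addRoot_injective :
    Function.Injective (addRoot : RTree ↥({u}ᶜ : Set α) → RTree α) := by
  intro S T h
  have hp : ∀ x, S.addRootParent x = T.addRootParent x := fun x =>
    congrFun (congrArg RTree.parent h) x
  have hr : S.root = T.root := by
    by_contra hne
    have := hp S.root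
    rw [addRootParent_root, addRootParent_of_ne T hne] at this
    exact (T.parent S.root).2 this.symm
  refine ext_root_parent hr (funext fun x => ?_)
  by_cases hx : x = S.root
  · rw [hx, S.parent_root, hr, T.parent_root]
  · have := hp x
    rw [addRootParent_of_ne S hx, addRootParent_of_ne T (hr ▸ hx)] at this
    exact Subtype.ext this

end AddRoot

end RTree

section ElimTrees

variable {α : Type*} {G : SimpleGraph α}

theorem IsElimTree.addRoot (hG : G.Connected) {u : α} {S : RTree ↥({u}ᶜ : Set α)}
    (hS : IsElimTree (G.induce {u}ᶜ) S) : IsElimTree G S.addRoot := by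
  refine ⟨fun v => ?_, fun v w hvw => ?_⟩
  · by_cases hv : v = u
    · subst hv
      have : S.addRoot.subtree v = Set.univ := Set.eq_univ_of_forall S.addRoot_ancestor_root
      rw [this]
      exact (SimpleGraph.induceUnivIso G).connected_iff.mpr hG
    · let v' : ↥({u}ᶜ : Set α) := ⟨v, hv⟩
      let f : (G.induce {u}ᶜ).induce (S.subtree v') →g G.induce (S.addRoot.subtree v) :=
        { toFun := fun x => ⟨x.1.1, S.addRoot_ancestor_iff.mpr x.2⟩
          map_rel' := fun h => h }
      refine (hS.1 v').map f ?_
      rintro ⟨x, hx⟩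
      have hxu : x ≠ u := by
        rintro rfl
        obtain ⟨k, hk⟩ := hx
        exact hv (hk.symm.trans (S.addRoot.iterate_parent_root k))
      exact ⟨⟨⟨x, hxu⟩, S.addRoot_ancestor_iff.mp hx⟩, rfl⟩
  · by_cases hv : v = u
    · exact .inl (hv ▸ S.addRoot_ancestor_root w)
    by_cases hw : w = u
    · exact .inr (hw ▸ S.addRoot_ancestor_root v)
    exact (hS.2 ⟨v, hv⟩ ⟨w, hw⟩ hvw).imp S.addRoot_ancestor_iff.mpr S.addRoot_ancestor_iff.mpr

theorem exists_isElimTree_of_subsingleton [Subsingleton α] [Nonempty α] (G : SimpleGraph α) :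
    ∃ T : RTree α, IsElimTree G T := by
  obtain ⟨a⟩ := ‹Nonempty α›
  let T : RTree α := ⟨a, id, rfl, fun v => ⟨0, Subsingleton.elim _ _⟩⟩
  refine ⟨T, fun v => ?_, fun u v h => absurd (Subsingleton.elim u v) h.ne⟩
  have : Nonempty (T.subtree v) := ⟨v, T.ancestor_refl v⟩
  exact .of_subsingleton

theorem SimpleGraph.Connected.exists_ne_and_connected_induce_compl_singleton [Finite α]
    [Nontrivial α] (hG : G.Connected) :
    ∃ u v : α, u ≠ v ∧ (G.induce {u}ᶜ).Connected ∧ (G.induce {v}ᶜ).Connected := by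
  classical
  have := Fintype.ofFinite α
  obtain ⟨T, hle, hT⟩ := hG.exists_isTree_le
  obtain ⟨u, v, hne, hu, hv⟩ := hT.exists_ne_and_degree_eq_one
  have mono (w : α) : T.induce {w}ᶜ ≤ G.induce {w}ᶜ := fun _ _ h => hle h
  exact ⟨u, v, hne, (hT.connected.induce_compl_singleton_of_degree_eq_one hu).mono (mono u),
    (hT.connected.induce_compl_singleton_of_degree_eq_one hv).mono (mono v)⟩

theorem ncard_isElimTree_add_le [Finite α] (hG : G.Connected) {u v : α} (huv : u ≠ v) :
    {S | IsElimTree (G.induce {u}ᶜ) S}.ncard + {S | IsElimTree (G.induce {v}ᶜ) S}.ncard ≤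
      {S | IsElimTree G S}.ncard := by
  rw [← Set.ncard_image_of_injective {S | IsElimTree (G.induce {u}ᶜ) S} RTree.addRoot_injective,
    ← Set.ncard_image_of_injective {S | IsElimTree (G.induce {v}ᶜ) S} RTree.addRoot_injective,
    ← Set.ncard_union_eq]
  · refine Set.ncard_le_ncard ?_
    rintro _ (⟨S, hS, rfl⟩ | ⟨S, hS, rfl⟩) <;> exact hS.addRoot hG
  · rw [Set.disjoint_left]
    rintro _ ⟨S, -, rfl⟩ ⟨S', -, h⟩
    exact huv (congrArg RTree.root h).symm

theorem two_pow_le_ncard_isElimTree [Finite α] (hG : G.Connected) {n : ℕ}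
    (hn : Nat.card α = n + 1) : 2 ^ n ≤ {S | IsElimTree G S}.ncard := by
  induction n generalizing α with
  | zero =>
    obtain ⟨_, _⟩ := Nat.card_eq_one_iff_unique.mp hn
    exact (Set.ncard_pos).mpr (exists_isElimTree_of_subsingleton G)
  | succ n ih =>
    have : Nontrivial α := Finite.one_lt_card_iff_nontrivial.mp (by omega)
    have hcard (w : α) : Nat.card ↥({w}ᶜ : Set α) = n + 1 := by
      rw [Nat.card_coe_set_eq, Set.ncard_compl, hn, Set.ncard_singleton, Nat.add_sub_cancel]
    obtain ⟨u, v, huv, hu, hv⟩ := hG.exists_ne_and_connected_induce_compl_singleton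
    calc 2 ^ (n + 1) = 2 ^ n + 2 ^ n := by ring
      _ ≤ _ := add_le_add (ih hu (hcard u)) (ih hv (hcard v))
      _ ≤ _ := ncard_isElimTree_add_le hG huv

end ElimTrees

/-- A connected graph on `n` vertices has at least `2^(n−1)` elimination trees, and
consequently `log₂ |ET(G)| ≥ n − 1`. -/
theorem card_elimTrees_lower_bound {α : Type*} [Fintype α]
    (G : SimpleGraph α) (hG : G.Connected) :
    2 ^ (Fintype.card α - 1) ≤ {S : RTree α | IsElimTree G S}.ncard ∧
      (Fintype.card α : ℝ) - 1 ≤ Real.logb 2 ({S : RTree α | IsElimTree G S}.ncard : ℝ) := by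
  obtain ⟨n, hn⟩ : ∃ n, Fintype.card α = n + 1 :=
    have := hG.nonempty
    Nat.exists_eq_succ_of_ne_zero Fintype.card_ne_zero
  have key : 2 ^ n ≤ {S : RTree α | IsElimTree G S}.ncard :=
    two_pow_le_ncard_isElimTree hG (Nat.card_eq_fintype_card.trans hn)
  rw [hn, Nat.add_sub_cancel]
  refine ⟨key, ?_⟩
  have hpos : 0 < {S : RTree α | IsElimTree G S}.ncard := (Nat.two_pow_pos n).trans_le key
  rw [Real.le_logb_iff_rpow_le one_lt_two (by exact_mod_cast hpos), Nat.cast_add_one,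
    add_sub_cancel_right, Real.rpow_natCast]
  exact_mod_cast key
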